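/- arXiv:2001.00036 — 6 statements merged into one kernel-verified Lean document; each statement's English description precedes it below -/
import Mathlib

section
/- The Saint Venant–Kirchhoff stored energy density W₀(F) = ‖FᵀF − I‖² (Frobenius norm squared) on real 3×3 matrices is not rank-one convex: there exist real 3×3 matrices F₊ and F₋ such that the matrix F₊ − F₋ has rank 1, det F₊ > 0, det F₋ > 0, and W₀((F₊ + F₋)/2) > (1/2)·W₀(F₊) + (1/2)·W₀(F₋). -/
open Matrix

/-- Saint Venant–Kirchhoff stored energy density: squared Frobenius norm of FᵀF − I. -/
noncomputable def W0 (F : Matrix (Fin 3) (Fin 3) ℝ) : ℝ :=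
  ∑ i, ∑ j, ((Fᵀ * F - 1) i j) ^ 2

theorem stVenantKirchhoff_not_rankOneConvex :
    ∃ Fp Fm : Matrix (Fin 3) (Fin 3) ℝ,
      (Fp - Fm).rank = 1 ∧ 0 < Fp.det ∧ 0 < Fm.det ∧
      (1 / 2 : ℝ) * W0 Fp + (1 / 2 : ℝ) * W0 Fm < W0 ((1 / 2 : ℝ) • (Fp + Fm)) := by
  refine ⟨diagonal ![3 / 4, 1, 1], diagonal ![1 / 4, 1, 1], ?_, ?_, ?_, ?_⟩
  · rw [diagonal_sub, rank_diagonal, Fintype.card_eq_one_iff]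
    refine ⟨⟨0, by norm_num⟩, fun ⟨i, hi⟩ => ?_⟩
    fin_cases i
    · rfl
    all_goals exact absurd (sub_self (1 : ℝ)) hi
  · simp [det_diagonal, Fin.prod_univ_three]
  · simp [det_diagonal, Fin.prod_univ_three]
  · simp [W0, Fin.sum_univ_three, diagonal_add, ← diagonal_smul, one_apply, diagonal_apply]
    norm_num
end

section
/- Let 0 < ε < √2/2 with ε ≠ √2/2, let F = diag(ε, ε, 1), F₊ = [[ε, √(1−2ε²), 0], [0, ε, 0], [0, 0, 1]], F₋ = [[ε, −√(1−2ε²), 0], [0, ε, 0], [0, 0, 1]], and W₀(F) = ‖FᵀF − I‖². Then W₀(F) − (1/2)·W₀(F₊) − (1/2)·W₀(F₋) = (2ε² − 1)², which is strictly positive. -/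
open Matrix

noncomputable def Fp (ε : ℝ) : Matrix (Fin 3) (Fin 3) ℝ :=
  !![ε, Real.sqrt (1 - 2 * ε ^ 2), 0; 0, ε, 0; 0, 0, 1]

noncomputable def Fm (ε : ℝ) : Matrix (Fin 3) (Fin 3) ℝ :=
  !![ε, -Real.sqrt (1 - 2 * ε ^ 2), 0; 0, ε, 0; 0, 0, 1]

theorem W0_shear (a s : ℝ) :
    W0 !![a, s, 0; 0, a, 0; 0, 0, 1]
      = (a ^ 2 - 1) ^ 2 + 2 * (a * s) ^ 2 + (s ^ 2 + a ^ 2 - 1) ^ 2 := by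
  simp [W0, Fin.sum_univ_three, Matrix.mul_apply, Matrix.one_apply]
  ring

theorem diagonal_eq_shear_zero (a : ℝ) :
    Matrix.diagonal ![a, a, 1] = !![a, 0, 0; 0, a, 0; 0, 0, 1] := by
  ext i j
  fin_cases i <;> fin_cases j <;> simp

theorem energy_gap (ε : ℝ) (h0 : 0 < ε) (h1 : ε < Real.sqrt 2 / 2)
    (hne : ε ≠ Real.sqrt 2 / 2) :
    W0 (Matrix.diagonal ![ε, ε, 1]) - (1 / 2 : ℝ) * W0 (Fp ε) - (1 / 2 : ℝ) * W0 (Fm ε)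
      = (2 * ε ^ 2 - 1) ^ 2 ∧
    0 < (2 * ε ^ 2 - 1) ^ 2 := by
  have hε : 0 < 1 - 2 * ε ^ 2 := by
    have h2 : Real.sqrt 2 ^ 2 = 2 := Real.sq_sqrt (by norm_num)
    have h3 : ε ^ 2 < (Real.sqrt 2 / 2) ^ 2 := pow_lt_pow_left₀ h1 h0.le two_ne_zero
    rw [div_pow, h2] at h3
    linarith
  refine ⟨?_, sq_pos_of_neg (by linarith)⟩
  rw [diagonal_eq_shear_zero, Fp, Fm, W0_shear, W0_shear, W0_shear]
  simp only [mul_pow, neg_sq, Real.sq_sqrt hε.le]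
  ring
end

section
/- Let F be a real 3×3 matrix and a, b ∈ ℝ³, and define h : ℝ → ℝ by h(t) = W₀(F + t·(a bᵀ)), where a bᵀ denotes the 3×3 rank-one matrix with entries aᵢbⱼ and W₀(F) = ‖FᵀF − I‖². Then the second derivative of h at 0 equals 4·(‖a‖²·‖Fb‖² + ‖Fᵀa‖²·‖b‖² + ⟨Fᵀa, b⟩² − ‖a‖²·‖b‖²), where ‖·‖ and ⟨·,·⟩ denote the Euclidean norm and inner product on ℝ³. -/
open Matrix

theorem transpose_mul_self_add_smul_vecMulVec_apply (F : Matrix (Fin 3) (Fin 3) ℝ)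
    (a b : Fin 3 → ℝ) (t : ℝ) (i j : Fin 3) :
    ((F + t • vecMulVec a b)ᵀ * (F + t • vecMulVec a b) - 1) i j =
      (Fᵀ * F - 1) i j + t * ((Fᵀ *ᵥ a) i * b j + b i * (Fᵀ *ᵥ a) j)
        + t ^ 2 * ((∑ k, a k ^ 2) * (b i * b j)) := by
  simp only [Matrix.sub_apply, mul_apply, transpose_apply, Matrix.add_apply, Matrix.smul_apply, vecMulVec_apply,
    mulVec, dotProduct, Fin.sum_univ_three, smul_eq_mul]
  ring

theorem iteratedDeriv_two_sq_quadratic_zero (c s d : ℝ) :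
    iteratedDeriv 2 (fun t : ℝ => (c + t * s + t ^ 2 * d) ^ 2) 0 = 2 * s ^ 2 + 4 * (c * d) := by
  have hq (t : ℝ) : HasDerivAt (fun t : ℝ => c + t * s + t ^ 2 * d) (s + 2 * t * d) t := by
    simpa using (((hasDerivAt_id t).mul_const s).const_add c).fun_add
      ((hasDerivAt_pow 2 t).mul_const d)
  have hl : HasDerivAt (fun t : ℝ => s + 2 * t * d) (2 * d) 0 := by
    simpa using (((hasDerivAt_id (0 : ℝ)).const_mul 2).mul_const d).const_add s
  have h₁ : deriv (fun t : ℝ => (c + t * s + t ^ 2 * d) ^ 2) =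
      fun t => 2 * (c + t * s + t ^ 2 * d) * (s + 2 * t * d) := by
    funext t
    simpa using ((hq t).fun_pow 2).deriv
  rw [iteratedDeriv_succ, iteratedDeriv_one, h₁, (((hq 0).const_mul 2).fun_mul hl).deriv]
  ring

theorem second_derivative_along_rank_one (F : Matrix (Fin 3) (Fin 3) ℝ)
    (a b : Fin 3 → ℝ) :
    iteratedDeriv 2 (fun t : ℝ => W0 (F + t • Matrix.vecMulVec a b)) 0 =
      4 * ((∑ i, (a i) ^ 2) * (∑ i, (F.mulVec b i) ^ 2)
         + (∑ i, (Fᵀ.mulVec a i) ^ 2) * (∑ i, (b i) ^ 2)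
         + (∑ i, Fᵀ.mulVec a i * b i) ^ 2
         - (∑ i, (a i) ^ 2) * (∑ i, (b i) ^ 2)) := by
  simp only [W0, transpose_mul_self_add_smul_vecMulVec_apply]
  rw [iteratedDeriv_fun_sum fun i _ => by fun_prop]
  have hsum (i : Fin 3) := iteratedDeriv_fun_sum (n := 2) (x := (0 : ℝ)) (I := Finset.univ)
    (f := fun (j : Fin 3) (t : ℝ) =>
      ((Fᵀ * F - 1) i j + t * ((Fᵀ *ᵥ a) i * b j + b i * (Fᵀ *ᵥ a) j)
        + t ^ 2 * ((∑ k, a k ^ 2) * (b i * b j))) ^ 2) fun j _ => by fun_prop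
  simp only [hsum, iteratedDeriv_two_sq_quadratic_zero]
  simp only [Matrix.sub_apply, mul_apply, transpose_apply, mulVec, dotProduct, Fin.sum_univ_three,
    one_fin_three, of_apply, cons_val]
  ring
end

section
/- Let 0 < ε < √2/2, let F = diag(ε, ε, 1), a = (1,0,0), b = (0,1,0), and define h : ℝ → ℝ by h(t) = W₀(F + t·(a bᵀ)) with W₀(F) = ‖FᵀF − I‖². Then the second derivative of h at 0 equals 4(2ε² − 1), which is strictly negative; in particular W₀ fails the rank-one convexity (Legendre–Hadamard) condition at F. -/
open Matrix

/-- The energy along the rank-one line is an even quartic polynomial in `t`. -/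
theorem W0_diagonal_add_smul_vecMulVec (ε t : ℝ) :
    W0 (Matrix.diagonal ![ε, ε, 1] + t • Matrix.vecMulVec ![1, 0, 0] ![0, 1, 0]) =
      t ^ 4 + (4 * ε ^ 2 - 2) * t ^ 2 + 2 * (ε ^ 2 - 1) ^ 2 := by
  simp [W0, Fin.sum_univ_three, Matrix.mul_apply, Matrix.diagonal_apply, Matrix.one_apply]
  ring

theorem iteratedDeriv_two_even_quartic (b c : ℝ) :
    iteratedDeriv 2 (fun t : ℝ => t ^ 4 + b * t ^ 2 + c) 0 = 2 * b := by
  have h_first : deriv (fun t : ℝ => t ^ 4 + b * t ^ 2 + c) = fun t => 4 * t ^ 3 + b * (2 * t) := by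
    funext t
    have h := (((hasDerivAt_pow 4 t).add ((hasDerivAt_pow 2 t).const_mul b)).add_const c).deriv
    refine h.trans ?_
    norm_num
  have h_second := (((hasDerivAt_pow 3 (0 : ℝ)).const_mul 4).add
    (((hasDerivAt_id (0 : ℝ)).const_mul 2).const_mul b)).deriv
  rw [iteratedDeriv_succ, iteratedDeriv_one, h_first]
  refine h_second.trans ?_
  norm_num
  ring

theorem legendre_hadamard_fails (ε : ℝ) (h0 : 0 < ε) (h1 : ε < Real.sqrt 2 / 2) :
    iteratedDeriv 2
        (fun t : ℝ =>
          W0 (Matrix.diagonal ![ε, ε, 1] + t • Matrix.vecMulVec ![1, 0, 0] ![0, 1, 0])) 0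
      = 4 * (2 * ε ^ 2 - 1) ∧
    iteratedDeriv 2
        (fun t : ℝ =>
          W0 (Matrix.diagonal ![ε, ε, 1] + t • Matrix.vecMulVec ![1, 0, 0] ![0, 1, 0])) 0
      < 0 := by
  have h_deriv : iteratedDeriv 2
      (fun t : ℝ =>
        W0 (Matrix.diagonal ![ε, ε, 1] + t • Matrix.vecMulVec ![1, 0, 0] ![0, 1, 0])) 0
      = 4 * (2 * ε ^ 2 - 1) := by
    simp_rw [W0_diagonal_add_smul_vecMulVec, iteratedDeriv_two_even_quartic]
    ring
  refine ⟨h_deriv, h_deriv.trans_lt ?_⟩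
  have h_sqrt : Real.sqrt 2 ^ 2 = 2 := Real.sq_sqrt zero_le_two
  nlinarith
end

section
/- Define y : ℝ³ → ℝ³ by y(x₁, x₂, x₃) = (x₁², x₂·x₁^{4/5}, x₃·x₁²), so that on {x₁ > 0} its Jacobian cofactor is Cof ∇y(x) = [[x₁^{14/5}, −(4/5)·x₂·x₁^{9/5}, −2·x₁^{9/5}·x₃], [0, 2x₁³, 0], [0, 0, 2x₁^{9/5}]] and det ∇y(x) = 2·x₁^{19/5}. Then both of the maps x ↦ Cof ∇y(x) (into ℝ^{3×3} with any fixed norm) and x ↦ det ∇y(x) are Lipschitz continuous on the open cube Ω = (0,1)³, i.e., each is Lipschitz on Ω with some finite constant. -/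
open Matrix

/-- The cofactor of the Jacobian of y(x) = (x₁², x₂·x₁^{4/5}, x₃·x₁²) on {x₁ > 0}. -/
noncomputable def CofJac (x : Fin 3 → ℝ) : Matrix (Fin 3) (Fin 3) ℝ :=
  !![x 0 ^ ((14 : ℝ) / 5), -(4 / 5) * x 1 * x 0 ^ ((9 : ℝ) / 5), -2 * x 0 ^ ((9 : ℝ) / 5) * x 2;
     0, 2 * x 0 ^ 3, 0;
     0, 0, 2 * x 0 ^ ((9 : ℝ) / 5)]

/-- The determinant of the Jacobian of y on {x₁ > 0}. -/
noncomputable def detJac (x : Fin 3 → ℝ) : ℝ :=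
  2 * x 0 ^ ((19 : ℝ) / 5)

/-- The open unit cube (0,1)³. -/
def Ω : Set (Fin 3 → ℝ) := {x | ∀ i, x i ∈ Set.Ioo (0 : ℝ) 1}

theorem abs_rpow_sub_rpow_le {p a b : ℝ} (hp : 1 ≤ p) (ha : a ∈ Set.Ioo (0 : ℝ) 1)
    (hb : b ∈ Set.Ioo (0 : ℝ) 1) : |a ^ p - b ^ p| ≤ p * |a - b| := by
  refine (convex_Ioo (0 : ℝ) 1).norm_image_sub_le_of_norm_hasDerivWithin_le
    (f := fun t => t ^ p) (f' := fun t => p * t ^ (p - 1)) (fun t ht => ?_) (fun t ht => ?_) hb ha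
  · exact (Real.hasDerivAt_rpow_const (Or.inr hp)).hasDerivWithinAt
  · have h0 : 0 ≤ t ^ (p - 1) := Real.rpow_nonneg ht.1.le _
    have h1 : t ^ (p - 1) ≤ 1 := Real.rpow_le_one ht.1.le ht.2.le (by linarith)
    rw [Real.norm_eq_abs, abs_of_nonneg (by positivity)]
    nlinarith

theorem abs_mul_sub_mul_le {a b c d A B : ℝ} (hb : |b| ≤ 1) (hc : |c| ≤ 1)
    (hac : |a - c| ≤ A) (hbd : |b - d| ≤ B) : |a * b - c * d| ≤ A + B := by
  have h : a * b - c * d = (a - c) * b + c * (b - d) := by ring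
  rw [h]
  refine (abs_add_le _ _).trans (add_le_add ?_ ?_)
  · rw [abs_mul]
    exact (mul_le_of_le_one_right (abs_nonneg _) hb).trans hac
  · rw [abs_mul]
    exact (mul_le_of_le_one_left (abs_nonneg _) hc).trans hbd

theorem abs_CofJac_sub_le {x x' : Fin 3 → ℝ} (hx : x ∈ Ω) (hx' : x' ∈ Ω) (i j : Fin 3) :
    |CofJac x i j - CofJac x' i j| ≤ 6 * dist x x' := by
  have hd : ∀ k, |x k - x' k| ≤ dist x x' := fun k => dist_le_pi_dist x x' k
  have hd0 : 0 ≤ dist x x' := dist_nonneg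
  have habs : ∀ {y : Fin 3 → ℝ}, y ∈ Ω → ∀ k, |y k| ≤ 1 := fun hy k =>
    abs_le.2 ⟨by linarith [(hy k).1], (hy k).2.le⟩
  have hpow : ∀ p : ℝ, 1 ≤ p → |x 0 ^ p - x' 0 ^ p| ≤ p * dist x x' := fun p hp =>
    (abs_rpow_sub_rpow_le hp (hx 0) (hx' 0)).trans
      (mul_le_mul_of_nonneg_left (hd 0) (by linarith))
  have hx1 : |x 0 ^ ((9 : ℝ) / 5)| ≤ 1 := by
    rw [abs_of_nonneg (Real.rpow_nonneg (hx 0).1.le _)]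
    exact Real.rpow_le_one (hx 0).1.le (hx 0).2.le (by norm_num)
  have h14 := abs_le.1 (hpow (14 / 5) (by norm_num))
  have h9 := hpow (9 / 5) (by norm_num)
  have h3 := hpow (3 : ℕ) (by norm_num)
  simp only [Real.rpow_natCast] at h3
  have h1 := abs_le.1 (abs_mul_sub_mul_le hx1 (habs hx' 1) (hd 1) h9)
  have h2 := abs_le.1 (abs_mul_sub_mul_le hx1 (habs hx' 2) (hd 2) h9)
  rw [abs_le] at h9 h3
  push_cast at h3
  rw [abs_le]
  fin_cases i <;> fin_cases j <;> simp [CofJac] <;> constructor <;> linarith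

theorem cof_and_det_lipschitz :
    (∃ L₁ : ℝ, 0 ≤ L₁ ∧ ∀ x ∈ Ω, ∀ x' ∈ Ω,
        Real.sqrt (∑ i, ∑ j, (CofJac x i j - CofJac x' i j) ^ 2) ≤ L₁ * dist x x') ∧
    (∃ L₂ : ℝ, 0 ≤ L₂ ∧ ∀ x ∈ Ω, ∀ x' ∈ Ω,
        |detJac x - detJac x'| ≤ L₂ * dist x x') := by
  refine ⟨⟨18, by norm_num, fun x hx x' hx' => ?_⟩, ⟨38 / 5, by norm_num, fun x hx x' hx' => ?_⟩⟩
  · refine Real.sqrt_le_iff.2 ⟨by positivity, ?_⟩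
    calc ∑ i, ∑ j, (CofJac x i j - CofJac x' i j) ^ 2
        ≤ ∑ _i : Fin 3, ∑ _j : Fin 3, (6 * dist x x') ^ 2 :=
          Finset.sum_le_sum fun i _ => Finset.sum_le_sum fun j _ =>
            sq_le_sq.2 ((abs_CofJac_sub_le hx hx' i j).trans (le_abs_self _))
      _ = (18 * dist x x') ^ 2 := by
          simp only [Finset.sum_const, Finset.card_univ, Fintype.card_fin, nsmul_eq_mul]
          push_cast
          ring
  · have h := abs_rpow_sub_rpow_le (p := 19 / 5) (by norm_num) (hx 0) (hx' 0)
    have hd : |x 0 - x' 0| ≤ dist x x' := dist_le_pi_dist x x' 0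
    rw [detJac, detJac, ← mul_sub, abs_mul, abs_two]
    linarith
end

section
/- Define y : ℝ³ → ℝ³ by y(x₁, x₂, x₃) = (x₁², x₂·x₁^{4/5}, x₃·x₁²). Then y is bounded on the open cube (0,1)³ (indeed mapping it into [0,1]³), and for every real p with 1 ≤ p < 5 the function x ↦ ‖∇y(x)‖^p (with ∇y the Jacobian matrix on {x₁ > 0} and ‖·‖ the Frobenius norm) is Lebesgue integrable on (0,1)³; that is, y ∈ W^{1,p}((0,1)³; ℝ³) ∩ L^∞((0,1)³; ℝ³) for every 1 ≤ p < 5. -/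
open Matrix MeasureTheory

/-- The deformation y(x₁,x₂,x₃) = (x₁², x₂·x₁^{4/5}, x₃·x₁²). -/
noncomputable def y (x : Fin 3 → ℝ) : Fin 3 → ℝ :=
  ![x 0 ^ 2, x 1 * x 0 ^ ((4 : ℝ) / 5), x 2 * x 0 ^ 2]

/-- The Jacobian matrix of y on {x₁ > 0}. -/
noncomputable def Jac (x : Fin 3 → ℝ) : Matrix (Fin 3) (Fin 3) ℝ :=
  !![2 * x 0, 0, 0;
     (4 / 5) * x 1 * x 0 ^ (-(1 : ℝ) / 5), x 0 ^ ((4 : ℝ) / 5), 0;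
     2 * x 0 * x 2, 0, x 0 ^ 2]

lemma sqrt_sum_Jac_sq_le {x : Fin 3 → ℝ} (hx : x ∈ Ω) :
    Real.sqrt (∑ i, ∑ j, (Jac x i j) ^ 2) ≤ 4 * x 0 ^ (-(1 : ℝ) / 5) := by
  obtain ⟨h0, h0'⟩ := hx 0
  obtain ⟨h1, h1'⟩ := hx 1
  obtain ⟨h2, h2'⟩ := hx 2
  have ha : 1 ≤ x 0 ^ (-(1 : ℝ) / 5) :=
    Real.one_le_rpow_of_pos_of_le_one_of_nonpos h0 h0'.le (by norm_num)
  have hb : x 0 ^ ((4 : ℝ) / 5) ≤ 1 := Real.rpow_le_one h0.le h0'.le (by norm_num)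
  have hb0 : 0 ≤ x 0 ^ ((4 : ℝ) / 5) := Real.rpow_nonneg h0.le _
  refine Real.sqrt_le_iff.mpr ⟨by linarith, ?_⟩
  simp only [Jac, Fin.sum_univ_three, Matrix.of_apply, Matrix.cons_val]
  generalize x 0 ^ (-(1 : ℝ) / 5) = a at *
  generalize x 0 ^ ((4 : ℝ) / 5) = b at *
  have e0 : x 0 ^ 2 ≤ 1 := pow_le_one₀ h0.le h0'.le
  have e1 : x 1 ^ 2 ≤ 1 := pow_le_one₀ h1.le h1'.le
  have e2 : x 2 ^ 2 ≤ 1 := pow_le_one₀ h2.le h2'.le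
  have e3 : b ^ 2 ≤ 1 := pow_le_one₀ hb0 hb
  have e4 : (x 0 ^ 2) ^ 2 ≤ 1 := pow_le_one₀ (sq_nonneg _) e0
  have e5 : x 1 ^ 2 * a ^ 2 ≤ a ^ 2 := mul_le_of_le_one_left (sq_nonneg _) e1
  have e6 : x 0 ^ 2 * x 2 ^ 2 ≤ 1 := mul_le_one₀ e0 (sq_nonneg _) e2
  have e7 : 1 ≤ a ^ 2 := one_le_pow₀ ha
  nlinarith

lemma Ω_eq_pi : Ω = Set.univ.pi fun _ : Fin 3 => Set.Ioo (0 : ℝ) 1 := by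
  ext x
  simp [Ω]

lemma measurableSet_Ω : MeasurableSet Ω := by
  rw [Ω_eq_pi]
  exact MeasurableSet.univ_pi fun _ => measurableSet_Ioo

lemma integrableOn_Ω_rpow {s : ℝ} (hs : -1 < s) :
    IntegrableOn (fun x : Fin 3 → ℝ => x 0 ^ s) Ω volume := by
  rw [IntegrableOn, Ω_eq_pi, volume_pi, Measure.restrict_pi_pi]
  have h : ∀ i : Fin 3, Integrable ((![fun t : ℝ => t ^ s, fun _ => 1, fun _ => 1] :
      Fin 3 → ℝ → ℝ) i) (volume.restrict (Set.Ioo (0 : ℝ) 1)) := by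
    intro i
    fin_cases i
    · exact (intervalIntegral.integrableOn_Ioo_rpow_iff one_pos).mpr hs
    · exact integrable_const _
    · exact integrable_const _
  simpa [Fin.prod_univ_three] using Integrable.fintype_prod h

lemma measurable_Jac_apply (i j : Fin 3) : Measurable fun x => Jac x i j := by
  fin_cases i <;> fin_cases j <;> simp [Jac] <;> fun_prop

theorem y_in_W1p_cap_Linfty :
    (∀ x ∈ Ω, ∀ i : Fin 3, y x i ∈ Set.Icc (0 : ℝ) 1) ∧
    ∀ p : ℝ, 1 ≤ p → p < 5 →
      IntegrableOn
        (fun x : Fin 3 → ℝ => Real.sqrt (∑ i, ∑ j, (Jac x i j) ^ 2) ^ p) Ω volume := by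
  refine ⟨fun x hx i => ?_, fun p hp hp5 => ?_⟩
  · have h0 := hx 0
    have h1 := hx 1
    have h2 := hx 2
    have hb : x 0 ^ ((4 : ℝ) / 5) ≤ 1 := Real.rpow_le_one h0.1.le h0.2.le (by norm_num)
    have hb0 : 0 ≤ x 0 ^ ((4 : ℝ) / 5) := Real.rpow_nonneg h0.1.le _
    have hc : x 0 ^ 2 ≤ 1 := pow_le_one₀ h0.1.le h0.2.le
    fin_cases i
    · exact ⟨sq_nonneg _, hc⟩
    · exact ⟨mul_nonneg h1.1.le hb0, mul_le_one₀ h1.2.le hb0 hb⟩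
    · exact ⟨mul_nonneg h2.1.le (sq_nonneg _), mul_le_one₀ h2.2.le (sq_nonneg _) hc⟩
  · have hp0 : 0 ≤ p := by linarith
    have hdom := (integrableOn_Ω_rpow (s := -(1 : ℝ) / 5 * p) (by linarith)).const_mul (4 ^ p)
    refine Integrable.mono' hdom ?_ ?_
    · have := measurable_Jac_apply
      exact Measurable.aestronglyMeasurable (by fun_prop)
    · refine ae_restrict_of_forall_mem measurableSet_Ω fun x hx => ?_
      have h0 : 0 ≤ x 0 := (hx 0).1.le
      rw [Real.norm_of_nonneg (by positivity), Real.rpow_mul h0,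
        ← Real.mul_rpow (by norm_num) (Real.rpow_nonneg h0 _)]
      exact Real.rpow_le_rpow (Real.sqrt_nonneg _) (sqrt_sum_Jac_sq_le hx) hp0
end
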